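/- arXiv:math/0610171 — 2 statements merged into one kernel-verified Lean document; each statement's English description precedes it below -/
import Mathlib

section
/- Let A be a Banach algebra with unitization A#, and let n ∈ ℕ. If A is (2n−1)-ideally amenable, then A# is (2n−1)-ideally amenable. -/
/- ## Core definitions: Banach bimodules over (non-unital) complex Banach algebras,
iterated dual modules, derivations, ideal amenability, and Arens extensions. -/

noncomputable section

open ContinuousLinearMap

universe u

/-- The topological dual of a complex normed space. -/
abbrev Dl (X : Type u) [SeminormedAddCommGroup X] [NormedSpace ℂ X] : Type u := X →L[ℂ] ℂ

/-- The canonical embedding of a normed space into its double dual. -/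
def inclDD (X : Type u) [SeminormedAddCommGroup X] [NormedSpace ℂ X] : X →L[ℂ] Dl (Dl X) :=
  ContinuousLinearMap.apply ℂ ℂ

@[simp] lemma inclDD_apply {X : Type u} [SeminormedAddCommGroup X] [NormedSpace ℂ X]
    (x : X) (f : Dl X) : inclDD X x f = f x := rfl

/-- A (bounded) Banach bimodule structure of a complex Banach algebra `A`
on a complex Banach space `X`:  `l a x = a • x` and `r a x = x • a`. -/
structure Bimodule (A : Type u) [NonUnitalNormedRing A] [NormedSpace ℂ A]
    [SMulCommClass ℂ A A] [IsScalarTower ℂ A A]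
    (X : Type u) [NormedAddCommGroup X] [NormedSpace ℂ X] : Type u where
  l : A →L[ℂ] X →L[ℂ] X
  r : A →L[ℂ] X →L[ℂ] X
  l_mul : ∀ a b x, l (a * b) x = l a (l b x)
  r_mul : ∀ a b x, r (a * b) x = r b (r a x)
  lr : ∀ a b x, l a (r b x) = r b (l a x)

variable {A : Type u} [NonUnitalNormedRing A] [NormedSpace ℂ A]
  [SMulCommClass ℂ A A] [IsScalarTower ℂ A A]

/-- The dual module of a Banach bimodule: `(a·f)(x) = f(x·a)` and `(f·a)(x) = f(a·x)`. -/
def Bimodule.dualMod {X : Type u} [NormedAddCommGroup X] [NormedSpace ℂ X]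
    (M : Bimodule A X) : Bimodule A (Dl X) where
  l := ((ContinuousLinearMap.compL ℂ X X ℂ).flip).comp M.r
  r := ((ContinuousLinearMap.compL ℂ X X ℂ).flip).comp M.l
  l_mul := fun a b f => by
    ext x
    simp [M.r_mul]
  r_mul := fun a b f => by
    ext x
    simp [M.l_mul]
  lr := fun a b f => by
    ext x
    simp [M.lr]

@[simp] lemma Bimodule.dualMod_l_apply {X : Type u} [NormedAddCommGroup X] [NormedSpace ℂ X]
    (M : Bimodule A X) (a : A) (f : Dl X) (x : X) :
    M.dualMod.l a f x = f (M.r a x) := by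
  simp [Bimodule.dualMod]

@[simp] lemma Bimodule.dualMod_r_apply {X : Type u} [NormedAddCommGroup X] [NormedSpace ℂ X]
    (M : Bimodule A X) (a : A) (f : Dl X) (x : X) :
    M.dualMod.r a f x = f (M.l a x) := by
  simp [Bimodule.dualMod]

/-- A Banach `A`-bimodule, bundled with its underlying space. -/
structure BMod (A : Type u) [NonUnitalNormedRing A] [NormedSpace ℂ A]
    [SMulCommClass ℂ A A] [IsScalarTower ℂ A A] : Type (u + 1) where
  X : Type u
  [xGroup : NormedAddCommGroup X]
  [xSpace : NormedSpace ℂ X]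
  act : Bimodule A X

attribute [instance] BMod.xGroup BMod.xSpace

/-- The dual of a bundled Banach bimodule. -/
def BMod.dualObj (M : BMod A) : BMod A :=
  ⟨Dl M.X, M.act.dualMod⟩

/-- The `n`-th dual of a bundled Banach bimodule (`iter 0 = M`). -/
def BMod.iter (M : BMod A) : ℕ → BMod A
  | 0 => M
  | n + 1 => (M.iter n).dualObj

/-- A bounded derivation from `A` into the Banach `A`-bimodule `M`. -/
def IsDerivation (M : BMod A) (D : A →L[ℂ] M.X) : Prop :=
  ∀ a b : A, D (a * b) = M.act.l a (D b) + M.act.r b (D a)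

/-- An inner derivation.  -/
def IsInner (M : BMod A) (D : A →L[ℂ] M.X) : Prop :=
  ∃ x : M.X, ∀ a : A, D a = M.act.l a x - M.act.r a x

/-- `H¹(A, M) = {0}` : every bounded derivation into `M` is inner. -/
def H1Zero (M : BMod A) : Prop :=
  ∀ D : A →L[ℂ] M.X, IsDerivation M D → IsInner M D

/-- A closed two-sided ideal of the Banach algebra `A`. -/
structure ClosedIdeal (A : Type u) [NonUnitalNormedRing A] [NormedSpace ℂ A]
    [SMulCommClass ℂ A A] [IsScalarTower ℂ A A] : Type u where
  car : Submodule ℂ A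
  isClosed : IsClosed (car : Set A)
  mul_mem_left : ∀ (a x : A), x ∈ car → a * x ∈ car
  mul_mem_right : ∀ (a x : A), x ∈ car → x * a ∈ car

namespace ClosedIdeal

variable (I : ClosedIdeal A)

/-- Left multiplication action of `A` on a closed two-sided ideal. -/
def lAct : A →L[ℂ] ↥I.car →L[ℂ] ↥I.car :=
  LinearMap.mkContinuous₂
    (LinearMap.mk₂ ℂ
      (fun a x => (⟨a * (x : A), I.mul_mem_left a x x.2⟩ : ↥I.car))
      (fun a b x => Subtype.ext <| by simp [add_mul])
      (fun c a x => Subtype.ext <| by simp [smul_mul_assoc])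
      (fun a x y => Subtype.ext <| by simp [mul_add])
      (fun c a x => Subtype.ext <| by simp [mul_smul_comm]))
    1
    (fun a x => by
      simp only [LinearMap.mk₂_apply, one_mul]
      calc ‖(⟨a * (x : A), I.mul_mem_left a x x.2⟩ : ↥I.car)‖ = ‖a * (x : A)‖ := rfl
        _ ≤ ‖a‖ * ‖(x : A)‖ := norm_mul_le _ _
        _ = ‖a‖ * ‖x‖ := by rw [Submodule.coe_norm])

/-- Right multiplication action of `A` on a closed two-sided ideal. -/
def rAct : A →L[ℂ] ↥I.car →L[ℂ] ↥I.car :=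
  LinearMap.mkContinuous₂
    (LinearMap.mk₂ ℂ
      (fun a x => (⟨(x : A) * a, I.mul_mem_right a x x.2⟩ : ↥I.car))
      (fun a b x => Subtype.ext <| by simp [mul_add])
      (fun c a x => Subtype.ext <| by simp [mul_smul_comm])
      (fun a x y => Subtype.ext <| by simp [add_mul])
      (fun c a x => Subtype.ext <| by simp [smul_mul_assoc]))
    1
    (fun a x => by
      simp only [LinearMap.mk₂_apply, one_mul]
      calc ‖(⟨(x : A) * a, I.mul_mem_right a x x.2⟩ : ↥I.car)‖ = ‖(x : A) * a‖ := rfl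
        _ ≤ ‖(x : A)‖ * ‖a‖ := norm_mul_le _ _
        _ = ‖x‖ * ‖a‖ := by rw [Submodule.coe_norm]
        _ = ‖a‖ * ‖x‖ := mul_comm _ _)

@[simp] lemma lAct_apply (a : A) (x : ↥I.car) : (I.lAct a x : A) = a * (x : A) := rfl
@[simp] lemma rAct_apply (a : A) (x : ↥I.car) : (I.rAct a x : A) = (x : A) * a := rfl

/-- A closed two-sided ideal as a Banach `A`-bimodule. -/
def toBMod : BMod A where
  X := ↥I.car
  act :=
    { l := I.lAct
      r := I.rAct
      l_mul := fun a b x => Subtype.ext <| by simp [mul_assoc]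
      r_mul := fun a b x => Subtype.ext <| by simp [mul_assoc]
      lr := fun a b x => Subtype.ext <| by simp [mul_assoc] }

end ClosedIdeal

/-- The Banach algebra `A` as a Banach bimodule over itself. -/
def regBMod (A : Type u) [NonUnitalNormedRing A] [NormedSpace ℂ A]
    [SMulCommClass ℂ A A] [IsScalarTower ℂ A A] : BMod A where
  X := A
  act :=
    { l := ContinuousLinearMap.mul ℂ A
      r := (ContinuousLinearMap.mul ℂ A).flip
      l_mul := fun a b x => by simp [mul_assoc]
      r_mul := fun a b x => by simp [mul_assoc]
      lr := fun a b x => by simp [mul_assoc] }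

/-- `A` is `n`-`I`-weakly amenable: `H¹(A, I⁽ⁿ⁾) = {0}`. -/
def NIWeaklyAmenable (I : ClosedIdeal A) (n : ℕ) : Prop :=
  H1Zero (I.toBMod.iter n)

/-- `A` is `n`-ideally amenable. -/
def NIdeallyAmenable (A : Type u) [NonUnitalNormedRing A] [NormedSpace ℂ A]
    [SMulCommClass ℂ A A] [IsScalarTower ℂ A A] (n : ℕ) : Prop :=
  ∀ I : ClosedIdeal A, H1Zero (I.toBMod.iter n)

/-- `A` is `n`-weakly amenable: `H¹(A, A⁽ⁿ⁾) = {0}`. -/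
def NWeaklyAmenable (A : Type u) [NonUnitalNormedRing A] [NormedSpace ℂ A]
    [SMulCommClass ℂ A A] [IsScalarTower ℂ A A] (n : ℕ) : Prop :=
  H1Zero ((regBMod A).iter n)

/- ## Arens-type extensions of bounded bilinear maps to biduals -/

section Arens

variable {E F G : Type*}
  [SeminormedAddCommGroup E] [NormedSpace ℂ E]
  [SeminormedAddCommGroup F] [NormedSpace ℂ F]
  [SeminormedAddCommGroup G] [NormedSpace ℂ G]

/-- Auxiliary map for the Arens extension:
`arT b Ψ g = (e ↦ Ψ (g ∘ b e))`. -/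
def arT (b : E →L[ℂ] F →L[ℂ] G) (Ψ : Dl (Dl F)) (g : Dl G) : Dl E :=
  LinearMap.mkContinuous
    { toFun := fun e => Ψ (g.comp (b e))
      map_add' := fun e e' => by simp only [map_add, ContinuousLinearMap.comp_add, map_add]
      map_smul' := fun c e => by
        simp only [map_smul, ContinuousLinearMap.comp_smul, map_smul, RingHom.id_apply] }
    (‖Ψ‖ * ‖g‖ * ‖b‖)
    (fun e => by
      calc ‖Ψ (g.comp (b e))‖ ≤ ‖Ψ‖ * ‖g.comp (b e)‖ := Ψ.le_opNorm _
        _ ≤ ‖Ψ‖ * (‖g‖ * ‖b e‖) := by gcongr; exact g.opNorm_comp_le _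
        _ ≤ ‖Ψ‖ * (‖g‖ * (‖b‖ * ‖e‖)) := by gcongr; exact b.le_opNorm e
        _ = ‖Ψ‖ * ‖g‖ * ‖b‖ * ‖e‖ := by ring)

@[simp] lemma arT_apply (b : E →L[ℂ] F →L[ℂ] G) (Ψ : Dl (Dl F)) (g : Dl G)
    (e : E) : arT b Ψ g e = Ψ (g.comp (b e)) := rfl

lemma arT_add_right (b : E →L[ℂ] F →L[ℂ] G) (Ψ Ψ' : Dl (Dl F)) (g : Dl G) :
    arT b (Ψ + Ψ') g = arT b Ψ g + arT b Ψ' g := by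
  ext e; simp

lemma arT_smul_right (b : E →L[ℂ] F →L[ℂ] G) (c : ℂ) (Ψ : Dl (Dl F)) (g : Dl G) :
    arT b (c • Ψ) g = c • arT b Ψ g := by
  ext e; simp

lemma arT_add_g (b : E →L[ℂ] F →L[ℂ] G) (Ψ : Dl (Dl F)) (g g' : Dl G) :
    arT b Ψ (g + g') = arT b Ψ g + arT b Ψ g' := by
  ext e; simp [ContinuousLinearMap.add_comp]

lemma arT_smul_g (b : E →L[ℂ] F →L[ℂ] G) (c : ℂ) (Ψ : Dl (Dl F)) (g : Dl G) :
    arT b Ψ (c • g) = c • arT b Ψ g := by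
  ext e; simp [ContinuousLinearMap.smul_comp]

/-- One half of the Arens extension: `(arExtFun b Φ Ψ) g = Φ (e ↦ Ψ (g ∘ b e))`. -/
def arExtFun (b : E →L[ℂ] F →L[ℂ] G) (Φ : Dl (Dl E)) (Ψ : Dl (Dl F)) :
    Dl (Dl G) :=
  LinearMap.mkContinuous
    { toFun := fun g => Φ (arT b Ψ g)
      map_add' := fun g g' => by simp only [arT_add_g, map_add]
      map_smul' := fun c g => by simp only [arT_smul_g, map_smul, RingHom.id_apply] }
    (‖Φ‖ * ‖Ψ‖ * ‖b‖)
    (fun g => by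
      calc ‖Φ (arT b Ψ g)‖ ≤ ‖Φ‖ * ‖arT b Ψ g‖ := Φ.le_opNorm _
        _ ≤ ‖Φ‖ * (‖Ψ‖ * ‖g‖ * ‖b‖) := by
            gcongr
            exact LinearMap.mkContinuous_norm_le _ (by positivity) _
        _ = ‖Φ‖ * ‖Ψ‖ * ‖b‖ * ‖g‖ := by ring)

@[simp] lemma arExtFun_apply (b : E →L[ℂ] F →L[ℂ] G) (Φ : Dl (Dl E))
    (Ψ : Dl (Dl F)) (g : Dl G) : arExtFun b Φ Ψ g = Φ (arT b Ψ g) := rfl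

lemma arExtFun_norm_le (b : E →L[ℂ] F →L[ℂ] G) (Φ : Dl (Dl E))
    (Ψ : Dl (Dl F)) : ‖arExtFun b Φ Ψ‖ ≤ ‖Φ‖ * ‖Ψ‖ * ‖b‖ :=
  LinearMap.mkContinuous_norm_le _ (by positivity) _

/-- The (first-)Arens-type extension of a bounded bilinear map `b : E × F → G` to the
biduals, obtained by iterated weak* limits (outer limit in the first variable):
`(arExt b Φ Ψ) g = Φ (e ↦ Ψ (g ∘ b e))`. -/
def arExt (b : E →L[ℂ] F →L[ℂ] G) :
    Dl (Dl E) →L[ℂ] Dl (Dl F) →L[ℂ] Dl (Dl G) :=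
  LinearMap.mkContinuous₂
    (LinearMap.mk₂ ℂ (arExtFun b)
      (fun Φ Φ' Ψ => by ext g; simp)
      (fun c Φ Ψ => by ext g; simp)
      (fun Φ Ψ Ψ' => by ext g; simp [arT_add_right])
      (fun c Φ Ψ => by ext g; simp [arT_smul_right]))
    ‖b‖
    (fun Φ Ψ => by
      simp only [LinearMap.mk₂_apply]
      exact (arExtFun_norm_le b Φ Ψ).trans (le_of_eq (by ring)))

@[simp] lemma arExt_apply (b : E →L[ℂ] F →L[ℂ] G) (Φ : Dl (Dl E))
    (Ψ : Dl (Dl F)) (g : Dl G) : arExt b Φ Ψ g = Φ (arT b Ψ g) := rfl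

end Arens

/- ## Arens products and Arens module extensions -/

/-- The first Arens product on the bidual of a Banach algebra. -/
def arensMul (A : Type u) [NonUnitalNormedRing A] [NormedSpace ℂ A]
    [SMulCommClass ℂ A A] [IsScalarTower ℂ A A] :
    Dl (Dl A) →L[ℂ] Dl (Dl A) →L[ℂ] Dl (Dl A) :=
  arExt (ContinuousLinearMap.mul ℂ A)

/-- The second Arens product on the bidual of a Banach algebra. -/
def arensMul₂ (A : Type u) [NonUnitalNormedRing A] [NormedSpace ℂ A]
    [SMulCommClass ℂ A A] [IsScalarTower ℂ A A]
    (F G : Dl (Dl A)) : Dl (Dl A) :=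
  arExt (ContinuousLinearMap.mul ℂ A).flip G F

namespace Bimodule

variable {X : Type u} [NormedAddCommGroup X] [NormedSpace ℂ X]

/-- First (iterated weak*-limit) extension of the left action:
`a'' · x'' = w*-lim_i lim_j a_i • x_j`. -/
def lExt (M : Bimodule A X) (F : Dl (Dl A)) (ξ : Dl (Dl X)) :
    Dl (Dl X) :=
  arExt M.l F ξ

/-- Second extension of the left action: `a'' · x'' = w*-lim_j lim_i a_i • x_j`. -/
def lExt₂ (M : Bimodule A X) (F : Dl (Dl A)) (ξ : Dl (Dl X)) :
    Dl (Dl X) :=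
  arExt M.l.flip ξ F

/-- First (iterated weak*-limit) extension of the right action:
`x'' · a'' = w*-lim_j lim_i x_j • a_i`. -/
def rExt (M : Bimodule A X) (ξ : Dl (Dl X)) (F : Dl (Dl A)) :
    Dl (Dl X) :=
  arExt M.r.flip ξ F

/-- Second extension of the right action: `x'' · a'' = w*-lim_i lim_j x_j • a_i`. -/
def rExt₂ (M : Bimodule A X) (ξ : Dl (Dl X)) (F : Dl (Dl A)) :
    Dl (Dl X) :=
  arExt M.r F ξ

/-- The topological centre of the right module action of `A` on `X`, i.e. the set of
`x'' ∈ X**` such that `a'' ↦ x'' · a''` is weak*-weak* continuous. -/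
def rTopCenter (M : Bimodule A X) : Set (Dl (Dl X)) :=
  {ξ | Continuous fun F : WeakDual ℂ (Dl A) => (M.rExt ξ F : WeakDual ℂ (Dl X))}

end Bimodule

/-- The topological centre of the bidual of a Banach algebra (with the first
Arens product): the set of `F ∈ A**` for which `G ↦ F □ G` is weak*-weak* continuous. -/
def arensTopCenter (A : Type u) [NonUnitalNormedRing A] [NormedSpace ℂ A]
    [SMulCommClass ℂ A A] [IsScalarTower ℂ A A] : Set (Dl (Dl A)) :=
  {F | Continuous fun G : WeakDual ℂ (Dl A) => (arensMul A F G : WeakDual ℂ (Dl A))}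

/- ## Adjoint maps -/

section DMap

variable {E F : Type*} [SeminormedAddCommGroup E] [NormedSpace ℂ E]
  [SeminormedAddCommGroup F] [NormedSpace ℂ F]

/-- The adjoint (dual map) of a bounded operator. -/
def dMap (f : E →L[ℂ] F) : Dl F →L[ℂ] Dl E :=
  (ContinuousLinearMap.compL ℂ E F ℂ).flip f

@[simp] lemma dMap_apply (f : E →L[ℂ] F) (g : Dl F) : dMap f g = g.comp f := rfl

/-- The canonical projection `X⁽⁴⁾ → X⁽²⁾`, i.e. the adjoint of the canonical
embedding `X* → X***`. -/
def Pmap (X : Type u) [SeminormedAddCommGroup X] [NormedSpace ℂ X] :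
    Dl (Dl (Dl (Dl X))) →L[ℂ] Dl (Dl X) :=
  dMap (inclDD (Dl X))

end DMap

/- ## The unitization `A ⊕ ℂ` with the norm `‖(a, α)‖ = ‖a‖ + |α|` -/

set_option synthInstance.maxHeartbeats 400000
set_option maxHeartbeats 1600000

section UnitizationL1

variable (A : Type u) [NonUnitalNormedRing A] [NormedSpace ℂ A]
  [SMulCommClass ℂ A A] [IsScalarTower ℂ A A]

/-- The unitization `A# = A ⊕ ℂ` of a Banach algebra `A` with product
`(a, α)(b, β) = (ab + αb + βa, αβ)` and norm `‖(a, α)‖ = ‖a‖ + |α|`. -/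
def UnitizL1 : Type u := Unitization ℂ A

namespace UnitizL1

instance instRing : Ring (UnitizL1 A) := inferInstanceAs (Ring (Unitization ℂ A))

instance instAlgebra : Algebra ℂ (UnitizL1 A) := inferInstanceAs (Algebra ℂ (Unitization ℂ A))

/-- Interpret an element of the unitization. -/
def toU (x : UnitizL1 A) : Unitization ℂ A := x

/-- The ℓ¹-norm on the unitization. -/
noncomputable def l1Norm : AddGroupNorm (UnitizL1 A) where
  toFun x := ‖(toU A x).snd‖ + ‖(toU A x).fst‖
  map_zero' := by
    show ‖(0 : A)‖ + ‖(0 : ℂ)‖ = 0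
    simp
  add_le' := fun x y => by
    have h1 : ‖(toU A (x + y)).snd‖ ≤ ‖(toU A x).snd‖ + ‖(toU A y).snd‖ := by
      simp only [toU, Unitization.snd_add]
      exact norm_add_le _ _
    have h2 : ‖(toU A (x + y)).fst‖ ≤ ‖(toU A x).fst‖ + ‖(toU A y).fst‖ := by
      simp only [toU, Unitization.fst_add]
      exact norm_add_le _ _
    linarith
  neg' := fun x => by
    have h1 : (toU A (-x)).snd = -(toU A x).snd := rfl
    have h2 : (toU A (-x)).fst = -(toU A x).fst := rfl
    rw [h1, h2, norm_neg, norm_neg]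
  eq_zero_of_map_eq_zero' := fun x h => by
    have h0 : ‖(toU A x).snd‖ + ‖(toU A x).fst‖ = 0 := h
    have h1 : ‖(toU A x).snd‖ = 0 ∧ ‖(toU A x).fst‖ = 0 := by
      constructor <;> nlinarith [norm_nonneg (toU A x).snd, norm_nonneg (toU A x).fst]
    have h2 : (toU A x).snd = 0 := norm_eq_zero.mp h1.1
    have h3 : (toU A x).fst = 0 := norm_eq_zero.mp h1.2
    show x = 0
    exact Unitization.ext h3 h2

noncomputable instance instNormedAddCommGroup : NormedAddCommGroup (UnitizL1 A) :=
  (l1Norm A).toNormedAddCommGroup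

lemma norm_def (x : UnitizL1 A) : ‖x‖ = ‖(toU A x).snd‖ + ‖(toU A x).fst‖ := rfl

noncomputable instance instNormedRing : NormedRing (UnitizL1 A) :=
  { instNormedAddCommGroup A, instRing A with
    norm_mul_le := fun x y => by
      rw [norm_def, norm_def, norm_def]
      have hfst : (toU A (x * y)).fst = (toU A x).fst * (toU A y).fst := rfl
      have hsnd : (toU A (x * y)).snd =
          (toU A x).fst • (toU A y).snd + (toU A y).fst • (toU A x).snd +
            (toU A x).snd * (toU A y).snd := rfl
      rw [hfst, hsnd]
      have h1 : ‖(toU A x).fst * (toU A y).fst‖ = ‖(toU A x).fst‖ * ‖(toU A y).fst‖ :=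
        norm_mul _ _
      have h2 : ‖(toU A x).fst • (toU A y).snd + (toU A y).fst • (toU A x).snd +
          (toU A x).snd * (toU A y).snd‖ ≤
          ‖(toU A x).fst‖ * ‖(toU A y).snd‖ + ‖(toU A y).fst‖ * ‖(toU A x).snd‖ +
            ‖(toU A x).snd‖ * ‖(toU A y).snd‖ := by
        refine (norm_add_le _ _).trans ?_
        have h3 := norm_add_le ((toU A x).fst • (toU A y).snd) ((toU A y).fst • (toU A x).snd)
        have h4 : ‖(toU A x).fst • (toU A y).snd‖ = ‖(toU A x).fst‖ * ‖(toU A y).snd‖ :=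
          norm_smul _ _
        have h5 : ‖(toU A y).fst • (toU A x).snd‖ = ‖(toU A y).fst‖ * ‖(toU A x).snd‖ :=
          norm_smul _ _
        have h6 : ‖(toU A x).snd * (toU A y).snd‖ ≤ ‖(toU A x).snd‖ * ‖(toU A y).snd‖ :=
          norm_mul_le _ _
        linarith
      rw [h1]
      nlinarith [norm_nonneg (toU A x).fst, norm_nonneg (toU A y).fst,
        norm_nonneg (toU A x).snd, norm_nonneg (toU A y).snd] }

noncomputable instance instNormedSpace : NormedSpace ℂ (UnitizL1 A) where
  norm_smul_le c x := by
    rw [norm_def, norm_def]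
    have hs : (toU A (c • x)).snd = c • (toU A x).snd := rfl
    have hf : (toU A (c • x)).fst = c • (toU A x).fst := rfl
    rw [hs, hf, norm_smul, norm_smul]
    ring_nf
    exact le_refl _

end UnitizL1

end UnitizationL1


namespace UnitizL1

variable (A)

/-- The embedding of `A` into its unitization. -/
def inrL : A →L[ℂ] UnitizL1 A :=
  LinearMap.mkContinuous
    { toFun := fun a => (Unitization.inr a : Unitization ℂ A)
      map_add' := fun a b => Unitization.inr_add ℂ a b
      map_smul' := fun c a => Unitization.inr_smul ℂ c a } 1
    (fun a => by
      change ‖a‖ + ‖(0 : ℂ)‖ ≤ 1 * ‖a‖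
      simp)

/-- The scalar part of an element of the unitization. -/
def fstL : UnitizL1 A →L[ℂ] ℂ :=
  LinearMap.mkContinuous
    { toFun := fun x => (toU A x).fst
      map_add' := fun _ _ => rfl
      map_smul' := fun _ _ => rfl } 1
    (fun x => by
      rw [norm_def, one_mul]
      exact le_add_of_nonneg_left (norm_nonneg _))

/-- The part of an element of the unitization that lies in `A`. -/
def sndL : UnitizL1 A →L[ℂ] A :=
  LinearMap.mkContinuous
    { toFun := fun x => (toU A x).snd
      map_add' := fun _ _ => rfl
      map_smul' := fun _ _ => rfl } 1
    (fun x => by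
      rw [norm_def, one_mul]
      exact le_add_of_nonneg_right (norm_nonneg _))

variable {A}

@[simp] lemma fstL_inrL (a : A) : fstL A (inrL A a) = 0 := rfl

@[simp] lemma sndL_inrL (a : A) : sndL A (inrL A a) = a := rfl

lemma fstL_mul (x y : UnitizL1 A) : fstL A (x * y) = fstL A x * fstL A y := rfl

lemma inrL_mul (a b : A) : inrL A (a * b) = inrL A a * inrL A b :=
  Unitization.inr_mul ℂ a b

lemma inrL_sndL_of_fstL_eq_zero {x : UnitizL1 A} (hx : fstL A x = 0) :
    inrL A (sndL A x) = x :=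
  Unitization.ext hx.symm rfl

lemma eq_smul_one_add_inrL (x : UnitizL1 A) :
    x = fstL A x • (1 : UnitizL1 A) + inrL A (sndL A x) := by
  refine Unitization.ext ?_ ?_
  · change fstL A x = fstL A x * 1 + 0
    simp
  · change sndL A x = fstL A x • (0 : A) + sndL A x
    simp

end UnitizL1

open UnitizL1

/-- A bounded map `A → X` intertwining the regular bimodule `A` with `X`, together with an
extension of `f ∈ A*` to a functional on `X` that is annihilated by both actions. -/
structure AnnihilatingExtension {X : Type u} [NormedAddCommGroup X] [NormedSpace ℂ X]
    (M : Bimodule A X) (f : Dl A) where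
  ι : A →L[ℂ] X
  F : Dl X
  l_ι : ∀ a b, M.l a (ι b) = ι (a * b)
  r_ι : ∀ a b, M.r b (ι a) = ι (a * b)
  F_ι : ∀ a, F (ι a) = f a
  F_l : ∀ a x, F (M.l a x) = 0
  F_r : ∀ a x, F (M.r a x) = 0

namespace AnnihilatingExtension

/-- Annihilating extensions pass to the bidual along the canonical embeddings. -/
def bidual {X : Type u} [NormedAddCommGroup X] [NormedSpace ℂ X]
    {M : Bimodule A X} {f : Dl A} (E : AnnihilatingExtension M f) :
    AnnihilatingExtension M.dualMod.dualMod f where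
  ι := (inclDD X).comp E.ι
  F := inclDD (Dl X) E.F
  l_ι := fun a b => by ext g; simp [E.l_ι]
  r_ι := fun a b => by ext g; simp [E.r_ι]
  F_ι := fun a => by simp [E.F_ι]
  F_l := fun a Φ => by
    have h : M.dualMod.r a E.F = 0 := by ext x; simp [E.F_l]
    simp [h]
  F_r := fun a Φ => by
    have h : M.dualMod.l a E.F = 0 := by ext x; simp [E.F_r]
    simp [h]

/-- A functional vanishing on products extends to the closed ideal `A` of `A`. -/
def ofTop (I : ClosedIdeal A) (hI : I.car = ⊤) (f : Dl A) (hf : ∀ a b, f (a * b) = 0) :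
    AnnihilatingExtension I.toBMod.act f where
  ι := (ContinuousLinearMap.id ℂ A).codRestrict I.car (fun a => by simp [hI])
  F := f.comp I.car.subtypeL
  l_ι := fun _ _ => rfl
  r_ι := fun _ _ => rfl
  F_ι := fun _ => rfl
  F_l := fun _ _ => hf _ _
  F_r := fun _ _ => hf _ _

lemma nonempty_iter {M : BMod A} {f : Dl A} (E : AnnihilatingExtension M.act f) (k : ℕ) :
    Nonempty (AnnihilatingExtension (M.iter (2 * k)).act f) := by
  induction k with
  | zero => exact ⟨E⟩
  | succ k ih =>
    obtain ⟨E'⟩ := ih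
    exact ⟨E'.bidual⟩

/-- If every derivation into the dual of `M` is inner, then only the zero functional
has an annihilating extension to `M`. -/
lemma eq_zero_of_h1Zero {M : BMod A} {f : Dl A} (E : AnnihilatingExtension M.act f)
    (hf : ∀ a b, f (a * b) = 0) (h : H1Zero M.dualObj) : f = 0 := by
  have hder : ∀ a b, f (a * b) • E.F =
      M.act.dualMod.l a (f b • E.F) + M.act.dualMod.r b (f a • E.F) := fun a b => by
    ext x
    simp [hf, E.F_l, E.F_r]
  obtain ⟨Φ, hΦ⟩ := h (f.smulRight E.F : A →L[ℂ] Dl M.X) hder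
  change Dl M.X at Φ
  ext a
  have h1 : f a • E.F = M.act.dualMod.l a Φ - M.act.dualMod.r a Φ := hΦ a
  have h2 := congrArg (fun g : Dl M.X => g (E.ι a)) h1
  simpa [E.l_ι, E.r_ι, E.F_ι] using h2

end AnnihilatingExtension

/-- Odd ideal amenability forces every functional vanishing on products to vanish. -/
lemma NIdeallyAmenable.eq_zero_of_forall_mul {k : ℕ} (h : NIdeallyAmenable A (2 * k + 1))
    {f : Dl A} (hf : ∀ a b, f (a * b) = 0) : f = 0 := by
  let T : ClosedIdeal A :=
    { car := ⊤
      isClosed := isClosed_univ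
      mul_mem_left := fun _ _ _ => trivial
      mul_mem_right := fun _ _ _ => trivial }
  obtain ⟨E⟩ := (AnnihilatingExtension.ofTop T rfl f hf).nonempty_iter k
  exact E.eq_zero_of_h1Zero hf (h T)

/-- An `A`-bimodule `X` realized as a complemented submodule of a unital `A#`-bimodule `Y`
that contains `A · Y` and `Y · A`. -/
structure AbsorbingRetract {X Y : Type u} [NormedAddCommGroup X] [NormedSpace ℂ X]
    [NormedAddCommGroup Y] [NormedSpace ℂ Y]
    (N : Bimodule A X) (M : Bimodule (UnitizL1 A) Y) where
  i : X →L[ℂ] Y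
  p : Y →L[ℂ] X
  p_i : ∀ x, p (i x) = x
  i_l : ∀ a x, i (N.l a x) = M.l (inrL A a) (i x)
  i_r : ∀ a x, i (N.r a x) = M.r (inrL A a) (i x)
  i_p_l : ∀ a y, i (p (M.l (inrL A a) y)) = M.l (inrL A a) y
  i_p_r : ∀ a y, i (p (M.r (inrL A a) y)) = M.r (inrL A a) y
  one_l : ∀ y, M.l 1 y = y
  one_r : ∀ y, M.r 1 y = y

namespace AbsorbingRetract

/-- Absorbing retracts pass to biduals. -/
def bidual {X Y : Type u} [NormedAddCommGroup X] [NormedSpace ℂ X]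
    [NormedAddCommGroup Y] [NormedSpace ℂ Y]
    {N : Bimodule A X} {M : Bimodule (UnitizL1 A) Y} (R : AbsorbingRetract N M) :
    AbsorbingRetract N.dualMod.dualMod M.dualMod.dualMod where
  i := dMap (dMap R.i)
  p := dMap (dMap R.p)
  p_i := fun Φ => by
    ext g
    change Φ ((g.comp R.p).comp R.i) = Φ g
    congr 1
    ext x
    simp [R.p_i]
  i_l := fun a Φ => by
    ext g
    change N.dualMod.dualMod.l a Φ (g.comp R.i) =
      M.dualMod.dualMod.l (inrL A a) (dMap (dMap R.i) Φ) g
    rw [Bimodule.dualMod_l_apply, Bimodule.dualMod_l_apply]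
    change _ = Φ ((M.dualMod.r (inrL A a) g).comp R.i)
    congr 1
    ext x
    simp [R.i_l]
  i_r := fun a Φ => by
    ext g
    change N.dualMod.dualMod.r a Φ (g.comp R.i) =
      M.dualMod.dualMod.r (inrL A a) (dMap (dMap R.i) Φ) g
    rw [Bimodule.dualMod_r_apply, Bimodule.dualMod_r_apply]
    change _ = Φ ((M.dualMod.l (inrL A a) g).comp R.i)
    congr 1
    ext x
    simp [R.i_r]
  i_p_l := fun a Φ => by
    ext g
    change M.dualMod.dualMod.l (inrL A a) Φ ((g.comp R.i).comp R.p) = _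
    rw [Bimodule.dualMod_l_apply, Bimodule.dualMod_l_apply]
    congr 1
    ext y
    simp [R.i_p_l]
  i_p_r := fun a Φ => by
    ext g
    change M.dualMod.dualMod.r (inrL A a) Φ ((g.comp R.i).comp R.p) = _
    rw [Bimodule.dualMod_r_apply, Bimodule.dualMod_r_apply]
    congr 1
    ext y
    simp [R.i_p_r]
  one_l := fun Φ => by
    ext g
    rw [Bimodule.dualMod_l_apply]
    congr 1
    ext y
    simp [R.one_l]
  one_r := fun Φ => by
    ext g
    rw [Bimodule.dualMod_r_apply]
    congr 1
    ext y
    simp [R.one_r]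

lemma nonempty_iter {N : BMod A} {M : BMod (UnitizL1 A)} (R : AbsorbingRetract N.act M.act)
    (k : ℕ) : Nonempty (AbsorbingRetract (N.iter (2 * k)).act (M.iter (2 * k)).act) := by
  induction k with
  | zero => exact ⟨R⟩
  | succ k ih =>
    obtain ⟨R'⟩ := ih
    exact ⟨R'.bidual⟩

/-- Vanishing of the first cohomology with coefficients in a dual module passes from an
absorbing retract to the ambient `A#`-module when `A²` is dense in `A`. -/
lemma h1Zero_dualObj {N : BMod A} {M : BMod (UnitizL1 A)} (R : AbsorbingRetract N.act M.act)
    (hA : ∀ f : Dl A, (∀ a b, f (a * b) = 0) → f = 0) (h : H1Zero N.dualObj) :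
    H1Zero M.dualObj := by
  intro D hD
  change UnitizL1 A →L[ℂ] Dl M.X at D
  have hD' : ∀ x y, D (x * y) = M.act.dualMod.l x (D y) + M.act.dualMod.r y (D x) := hD
  have hD_one : D 1 = 0 := by
    have h1 := hD' 1 1
    ext y
    have h2 := congrArg (fun g : Dl M.X => g y) h1
    simpa [R.one_l, R.one_r] using h2
  obtain ⟨φ, hφ⟩ := h ((dMap R.i).comp (D.comp (inrL A)) : A →L[ℂ] Dl N.X) (fun a b => by
    change (D (inrL A (a * b))).comp R.i =
      N.act.dualMod.l a ((D (inrL A b)).comp R.i) + N.act.dualMod.r b ((D (inrL A a)).comp R.i)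
    ext x
    simp [inrL_mul, hD', R.i_l, R.i_r])
  change Dl N.X at φ
  have hφ' : ∀ a x, D (inrL A a) (R.i x) = φ (N.act.r a x) - φ (N.act.l a x) := fun a x => by
    have h1 : (D (inrL A a)).comp R.i = N.act.dualMod.l a φ - N.act.dualMod.r a φ := hφ a
    simpa using congrArg (fun g : Dl N.X => g x) h1
  have key : ∀ a y, D (inrL A a) y =
      φ (R.p (M.act.r (inrL A a) y)) - φ (R.p (M.act.l (inrL A a) y)) := by
    intro a y
    let f : Dl A := (D.comp (inrL A)).flip y -
      ((φ.comp R.p).comp ((M.act.r.comp (inrL A)).flip y) -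
        (φ.comp R.p).comp ((M.act.l.comp (inrL A)).flip y))
    have hf : f = 0 := hA f (fun a b => by
      have hl : D (inrL A a) (M.act.l (inrL A b) y) =
          φ (R.p (M.act.r (inrL A a) (M.act.l (inrL A b) y))) -
            φ (R.p (M.act.l (inrL A a) (M.act.l (inrL A b) y))) := by
        rw [← R.i_p_l b y, hφ', ← R.i_l, ← R.i_r, R.p_i, R.p_i]
      have hr : D (inrL A b) (M.act.r (inrL A a) y) =
          φ (R.p (M.act.r (inrL A b) (M.act.r (inrL A a) y))) -
            φ (R.p (M.act.l (inrL A b) (M.act.r (inrL A a) y))) := by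
        rw [← R.i_p_r a y, hφ', ← R.i_l, ← R.i_r, R.p_i, R.p_i]
      simp [f, inrL_mul, hD', hl, hr, M.act.l_mul, M.act.r_mul, M.act.lr])
    have h1 := congrArg (fun g : Dl A => g a) hf
    simpa [f, sub_eq_zero] using h1
  refine ⟨(φ.comp R.p : Dl M.X), fun x => ?_⟩
  change D x = M.act.dualMod.l x (φ.comp R.p) - M.act.dualMod.r x (φ.comp R.p)
  ext y
  rw [eq_smul_one_add_inrL x]
  simp [hD_one, key, R.one_l, R.one_r]

end AbsorbingRetract

namespace ClosedIdeal

/-- The trace on `A` of a closed ideal of the unitization. -/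
def comapInr (I : ClosedIdeal (UnitizL1 A)) : ClosedIdeal A where
  car := I.car.comap (inrL A : A →ₗ[ℂ] UnitizL1 A)
  isClosed := I.isClosed.preimage (inrL A).continuous
  mul_mem_left := fun a x hx => by
    change inrL A (a * x) ∈ I.car
    rw [inrL_mul]
    exact I.mul_mem_left _ _ hx
  mul_mem_right := fun a x hx => by
    change inrL A (x * a) ∈ I.car
    rw [inrL_mul]
    exact I.mul_mem_right _ _ hx

lemma exists_fstL_mul_eq (I : ClosedIdeal (UnitizL1 A)) :
    ∃ e ∈ I.car, ∀ x ∈ I.car, fstL A x * fstL A e = fstL A x := by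
  by_cases hI : ∀ x ∈ I.car, fstL A x = 0
  · exact ⟨0, I.car.zero_mem, fun x hx => by simp [hI x hx]⟩
  · push Not at hI
    obtain ⟨e, he, he0⟩ := hI
    exact ⟨(fstL A e)⁻¹ • e, I.car.smul_mem _ he, fun x _ => by simp [he0]⟩

/-- The trace on `A` of a closed ideal of the unitization is an absorbing retract of it. -/
lemma nonempty_absorbingRetract (I : ClosedIdeal (UnitizL1 A)) :
    Nonempty (AbsorbingRetract I.comapInr.toBMod.act I.toBMod.act) := by
  obtain ⟨e, he, hfe⟩ := I.exists_fstL_mul_eq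
  let q : UnitizL1 A →L[ℂ] UnitizL1 A := ContinuousLinearMap.id ℂ _ - (fstL A).smulRight e
  have hq : ∀ x ∈ I.car, inrL A (sndL A (q x)) = q x := fun x hx =>
    inrL_sndL_of_fstL_eq_zero (by simp [q, hfe x hx])
  have hq0 : ∀ x, fstL A x = 0 → q x = x := fun x hx => by simp [q, hx]
  have hqI : ∀ x ∈ I.car, q x ∈ I.car := fun x hx =>
    I.car.sub_mem hx (I.car.smul_mem _ he)
  have hp : ∀ x : I.car, fstL A (x : UnitizL1 A) = 0 →
      inrL A (sndL A (q x)) = (x : UnitizL1 A) := fun x hx => by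
    rw [hq x x.2, hq0 x hx]
  refine ⟨{
    i := ((inrL A).comp I.comapInr.car.subtypeL).codRestrict I.car (fun x => x.2)
    p := ((sndL A).comp (q.comp I.car.subtypeL)).codRestrict I.comapInr.car (fun x => by
      change inrL A (sndL A (q x)) ∈ I.car
      rw [hq x x.2]
      exact hqI x x.2)
    p_i := fun x => Subtype.ext ?_
    i_l := fun a x => Subtype.ext (inrL_mul _ _)
    i_r := fun a x => Subtype.ext (inrL_mul _ _)
    i_p_l := fun a y => Subtype.ext (hp (I.lAct (inrL A a) y) ?_)
    i_p_r := fun a y => Subtype.ext (hp (I.rAct (inrL A a) y) ?_)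
    one_l := fun y => Subtype.ext (one_mul _)
    one_r := fun y => Subtype.ext (mul_one _) }⟩
  · change sndL A (q (inrL A x.1)) = x.1
    rw [hq0 _ (fstL_inrL _), sndL_inrL]
  · exact (fstL_mul _ _).trans (by rw [fstL_inrL, zero_mul])
  · exact (fstL_mul _ _).trans (by rw [fstL_inrL, mul_zero])

end ClosedIdeal

/-- **Proposition 2.1(ii).** If `A` is `(2n-1)`-ideally amenable, then the
unitization `A# = A ⊕ ℂ` is `(2n-1)`-ideally amenable. -/
theorem unitization_odd_ideally_amenable
    {A : Type u} [NonUnitalNormedRing A] [NormedSpace ℂ A]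
    [SMulCommClass ℂ A A] [IsScalarTower ℂ A A] [CompleteSpace A]
    (n : ℕ) (hn : 1 ≤ n)
    (h : NIdeallyAmenable A (2 * n - 1)) :
    NIdeallyAmenable (UnitizL1 A) (2 * n - 1) := by
  obtain ⟨k, rfl⟩ : ∃ k, n = k + 1 := ⟨n - 1, by omega⟩
  have hk : 2 * (k + 1) - 1 = 2 * k + 1 := by omega
  rw [hk] at h ⊢
  intro I
  obtain ⟨R⟩ := I.nonempty_absorbingRetract
  obtain ⟨R'⟩ := R.nonempty_iter k
  exact R'.h1Zero_dualObj (fun _ hf => h.eq_zero_of_forall_mul hf) (h I.comapInr)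
end
end

section
/- Let A be a commutative Banach algebra with unitization A#, and let n ∈ ℕ. If A is n-ideally amenable, then A# is n-ideally amenable. -/
/- ## Core definitions: Banach bimodules over (non-unital) complex Banach algebras,
iterated dual modules, derivations, ideal amenability, and Arens extensions. -/

noncomputable section

open ContinuousLinearMap

universe u

variable {A : Type u} [NonUnitalNormedRing A] [NormedSpace ℂ A]
  [SMulCommClass ℂ A A] [IsScalarTower ℂ A A]

/- ## The unitization `A ⊕ ℂ` with the norm `‖(a, α)‖ = ‖a‖ + |α|` -/

set_option synthInstance.maxHeartbeats 400000
set_option maxHeartbeats 1600000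

/-! ### Iterated duals of opposite pairs of bounded operators -/

section DMapLinear

variable {X Y : Type*} [SeminormedAddCommGroup X] [NormedSpace ℂ X]
  [SeminormedAddCommGroup Y] [NormedSpace ℂ Y]

lemma dMap_add (f g : X →L[ℂ] Y) : dMap (f + g) = dMap f + dMap g := by
  ext φ x
  exact map_add φ (f x) (g x)

lemma dMap_smul (c : ℂ) (f : X →L[ℂ] Y) : dMap (c • f) = c • dMap f := by
  ext φ x
  exact map_smul φ c (f x)

end DMapLinear

section IterPair

variable {A B C : Type u}
  [NonUnitalNormedRing A] [NormedSpace ℂ A] [SMulCommClass ℂ A A] [IsScalarTower ℂ A A]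
  [NonUnitalNormedRing B] [NormedSpace ℂ B] [SMulCommClass ℂ B B] [IsScalarTower ℂ B B]
  [NonUnitalNormedRing C] [NormedSpace ℂ C] [SMulCommClass ℂ C C] [IsScalarTower ℂ C C]

/-- A pair `f : X → Y`, `g : Y → X` induces a pair `X⁽ⁿ⁾ → Y⁽ⁿ⁾`, `Y⁽ⁿ⁾ → X⁽ⁿ⁾`: it is
`(f⁽ⁿ⁾, g⁽ⁿ⁾)` for even `n` and `(g⁽ⁿ⁾, f⁽ⁿ⁾)` for odd `n`. -/
def iterPair (M : BMod A) (N : BMod B) (f : M.X →L[ℂ] N.X) (g : N.X →L[ℂ] M.X) :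
    (n : ℕ) → ((M.iter n).X →L[ℂ] (N.iter n).X) × ((N.iter n).X →L[ℂ] (M.iter n).X)
  | 0 => (f, g)
  | n + 1 => (dMap (iterPair M N f g n).2, dMap (iterPair M N f g n).1)

lemma iterPair_comp (M : BMod A) (N : BMod B) (P : BMod C)
    (f : M.X →L[ℂ] N.X) (g : N.X →L[ℂ] M.X) (f' : N.X →L[ℂ] P.X) (g' : P.X →L[ℂ] N.X) (n : ℕ) :
    iterPair M P (f'.comp f) (g.comp g') n =
      ((iterPair N P f' g' n).1.comp (iterPair M N f g n).1,
        (iterPair M N f g n).2.comp (iterPair N P f' g' n).2) := by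
  induction n with
  | zero => rfl
  | succ n ih => simp only [iterPair, ih]; rfl

lemma iterPair_add (M : BMod A) (N : BMod B)
    (f f' : M.X →L[ℂ] N.X) (g g' : N.X →L[ℂ] M.X) (n : ℕ) :
    iterPair M N (f + f') (g + g') n = iterPair M N f g n + iterPair M N f' g' n := by
  induction n with
  | zero => rfl
  | succ n ih =>
    simp only [iterPair, ih, Prod.fst_add, Prod.snd_add, dMap_add]
    rfl

lemma iterPair_smul (M : BMod A) (N : BMod B) (c : ℂ)
    (f : M.X →L[ℂ] N.X) (g : N.X →L[ℂ] M.X) (n : ℕ) :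
    iterPair M N (c • f) (c • g) n = c • iterPair M N f g n := by
  induction n with
  | zero => rfl
  | succ n ih =>
    simp only [iterPair, ih, Prod.smul_fst, Prod.smul_snd, dMap_smul]
    rfl

lemma iterPair_zero (M : BMod A) (N : BMod B) (n : ℕ) : iterPair M N 0 0 n = 0 := by
  simpa using iterPair_smul M N 0 0 0 n

lemma iterPair_id (M : BMod A) (n : ℕ) :
    iterPair M M (.id ℂ M.X) (.id ℂ M.X) n = (.id ℂ _, .id ℂ _) := by
  induction n with
  | zero => rfl
  | succ n ih => simp only [iterPair, ih]; rfl

lemma iterPair_comp_apply (M : BMod A) (N : BMod B) (P : BMod C)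
    (f : M.X →L[ℂ] N.X) (g : N.X →L[ℂ] M.X) (f' : N.X →L[ℂ] P.X) (g' : P.X →L[ℂ] N.X) (n : ℕ)
    (v : (M.iter n).X) :
    (iterPair N P f' g' n).1 ((iterPair M N f g n).1 v) =
      (iterPair M P (f'.comp f) (g.comp g') n).1 v := by
  rw [iterPair_comp]
  rfl

lemma iterPair_act (M : BMod A) (a : A) (n : ℕ) :
    iterPair M M (M.act.l a) (M.act.r a) n = ((M.iter n).act.l a, (M.iter n).act.r a) := by
  induction n with
  | zero => rfl
  | succ n ih => simp only [iterPair, ih]; rfl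

lemma iter_act_l_eq_r {M : BMod A} {a : A} (h : M.act.l a = M.act.r a) (n : ℕ) :
    (M.iter n).act.l a = (M.iter n).act.r a := by
  induction n with
  | zero => exact h
  | succ n ih =>
    exact congrArg (compL ℂ _ _ ℂ).flip ih.symm

lemma iter_act_l_eq {M : BMod A} {a : A} (h : M.act.l a = M.act.r a) (n : ℕ) :
    (M.iter n).act.l a = (iterPair M M (M.act.l a) (M.act.l a) n).1 := by
  have hact := iterPair_act M a n
  rw [← h] at hact
  rw [hact]

/-- Pairs of maps intertwining symmetric actions induce intertwining maps of iterated duals. -/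
lemma iterPair_intertwine {M : BMod A} {N : BMod B} {a : A} {b : B}
    (ha : M.act.l a = M.act.r a) (hb : N.act.l b = N.act.r b)
    {f : M.X →L[ℂ] N.X} {g : N.X →L[ℂ] M.X}
    (hf : (N.act.l b).comp f = f.comp (M.act.l a)) (hg : g.comp (N.act.l b) = (M.act.l a).comp g)
    (n : ℕ) (v : (M.iter n).X) :
    (N.iter n).act.l b ((iterPair M N f g n).1 v) =
      (iterPair M N f g n).1 ((M.iter n).act.l a v) := by
  rw [iter_act_l_eq ha, iter_act_l_eq hb, iterPair_comp_apply, iterPair_comp_apply, hf, hg]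

end IterPair

lemma ClosedIdeal.act_l_eq_act_r {A : Type u} [NonUnitalNormedRing A] [NormedSpace ℂ A]
    [SMulCommClass ℂ A A] [IsScalarTower ℂ A A] (hcomm : ∀ a b : A, a * b = b * a)
    (J : ClosedIdeal A) (a : A) : J.toBMod.act.l a = J.toBMod.act.r a :=
  ContinuousLinearMap.ext fun x : J.car => Subtype.ext (hcomm a (x : A))

/-- In a commutative algebra, derivations into the iterated duals of an ideal with vanishing
first cohomology are zero. -/
lemma eq_zero_of_H1Zero_of_comm {A : Type u} [NonUnitalNormedRing A] [NormedSpace ℂ A]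
    [SMulCommClass ℂ A A] [IsScalarTower ℂ A A] (hcomm : ∀ a b : A, a * b = b * a)
    (J : ClosedIdeal A) {n : ℕ} (hJ : H1Zero (J.toBMod.iter n))
    (D : A →L[ℂ] (J.toBMod.iter n).X)
    (hD : ∀ a b, D (a * b) =
      (J.toBMod.iter n).act.l a (D b) + (J.toBMod.iter n).act.l b (D a)) (a : A) : D a = 0 := by
  have hs (a : A) : (J.toBMod.iter n).act.l a = (J.toBMod.iter n).act.r a :=
    iter_act_l_eq_r (J.act_l_eq_act_r hcomm a) n
  obtain ⟨x, hx⟩ := hJ D fun a b => by rw [hD, hs b]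
  rw [hx, hs, sub_self]

namespace UnitizL1

variable (A : Type u) [NonUnitalNormedRing A] [NormedSpace ℂ A]
  [SMulCommClass ℂ A A] [IsScalarTower ℂ A A]

/-- The canonical embedding `a ↦ (a, 0)` of an algebra into its unitization. -/
def inrCLM : A →L[ℂ] UnitizL1 A :=
  LinearMap.mkContinuous
    { toFun := fun a => (Unitization.inr a : Unitization ℂ A)
      map_add' := fun a b => Unitization.inr_add ℂ a b
      map_smul' := fun c a => Unitization.inr_smul ℂ c a } 1
    (fun a => by
      change ‖a‖ + ‖(0 : ℂ)‖ ≤ 1 * ‖a‖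
      simp)

/-- The character `(a, α) ↦ α` of the unitization. -/
def fstCLM : UnitizL1 A →L[ℂ] ℂ :=
  LinearMap.mkContinuous
    { toFun := fun x => (toU A x).fst
      map_add' := fun _ _ => rfl
      map_smul' := fun _ _ => rfl } 1
    (fun x => by
      rw [norm_def]
      change ‖(toU A x).fst‖ ≤ _
      linarith [norm_nonneg (toU A x).snd])

/-- The projection `(a, α) ↦ a` of the unitization. -/
def sndCLM : UnitizL1 A →L[ℂ] A :=
  LinearMap.mkContinuous
    { toFun := fun x => (toU A x).snd
      map_add' := fun _ _ => rfl
      map_smul' := fun _ _ => rfl } 1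
    (fun x => by
      rw [norm_def]
      change ‖(toU A x).snd‖ ≤ _
      linarith [norm_nonneg (toU A x).fst])

variable {A}

@[simp] lemma fstCLM_inrCLM (a : A) : fstCLM A (inrCLM A a) = 0 := rfl

@[simp] lemma sndCLM_inrCLM (a : A) : sndCLM A (inrCLM A a) = a := rfl

lemma ext' {x y : UnitizL1 A} (h₁ : fstCLM A x = fstCLM A y) (h₂ : sndCLM A x = sndCLM A y) :
    x = y :=
  Unitization.ext h₁ h₂

lemma fstCLM_mul (x y : UnitizL1 A) : fstCLM A (x * y) = fstCLM A x * fstCLM A y := rfl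

lemma sndCLM_mul (x y : UnitizL1 A) : sndCLM A (x * y) =
    fstCLM A x • sndCLM A y + fstCLM A y • sndCLM A x + sndCLM A x * sndCLM A y := rfl

lemma inrCLM_mul (a b : A) : inrCLM A (a * b) = inrCLM A a * inrCLM A b :=
  Unitization.inr_mul ℂ a b

lemma eq_add_smul_one (x : UnitizL1 A) : x = inrCLM A (sndCLM A x) + fstCLM A x • 1 := by
  refine ext' ?_ ?_
  · have h : fstCLM A (1 : UnitizL1 A) = 1 := rfl
    simp [h]
  · have h : sndCLM A (1 : UnitizL1 A) = 0 := rfl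
    simp [h]

lemma mul_comm_of_comm (hcomm : ∀ a b : A, a * b = b * a) (x y : UnitizL1 A) :
    x * y = y * x := by
  refine ext' ?_ ?_
  · rw [fstCLM_mul, fstCLM_mul, mul_comm]
  · rw [sndCLM_mul, sndCLM_mul, hcomm, add_comm (fstCLM A x • sndCLM A y)]

/-- The intersection of a closed ideal of the unitization with the original algebra. -/
def restrictIdeal (I : ClosedIdeal (UnitizL1 A)) : ClosedIdeal A where
  car := I.car.comap (inrCLM A).toLinearMap
  isClosed := I.isClosed.preimage (inrCLM A).continuous
  mul_mem_left a x hx := by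
    change inrCLM A (a * x) ∈ I.car
    rw [inrCLM_mul]
    exact I.mul_mem_left _ _ hx
  mul_mem_right a x hx := by
    change inrCLM A (x * a) ∈ I.car
    rw [inrCLM_mul]
    exact I.mul_mem_right _ _ hx

/-- The inclusion of `I ∩ A` into `I`. -/
def inclRestrict (I : ClosedIdeal (UnitizL1 A)) :
    (restrictIdeal I).toBMod.X →L[ℂ] I.toBMod.X :=
  let ι : (restrictIdeal I).car →L[ℂ] I.car :=
    ((inrCLM A).comp (restrictIdeal I).car.subtypeL).codRestrict I.car fun x => x.2
  ι

/-- The augmentation character restricted to an ideal. -/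
def idealFst (I : ClosedIdeal (UnitizL1 A)) : I.toBMod.X →L[ℂ] ℂ :=
  let φ : I.car →L[ℂ] ℂ := (fstCLM A).comp I.car.subtypeL
  φ

/-- An operator on `I` with values in the augmentation ideal, seen as an operator into `I ∩ A`. -/
def liftRestrict (I : ClosedIdeal (UnitizL1 A)) (T : I.toBMod.X →L[ℂ] I.toBMod.X)
    (hT : ∀ y, idealFst I (T y) = 0) :
    I.toBMod.X →L[ℂ] (restrictIdeal I).toBMod.X :=
  let T' : I.car →L[ℂ] I.car := T
  let m : I.car →L[ℂ] (restrictIdeal I).car :=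
    ((sndCLM A).comp (I.car.subtypeL.comp T')).codRestrict (restrictIdeal I).car fun y => by
      change inrCLM A (sndCLM A (T' y)) ∈ I.car
      rw [show inrCLM A (sndCLM A (T' y)) = (T' y : UnitizL1 A) from
        ext' (by rw [fstCLM_inrCLM]; exact (hT y).symm) (by simp)]
      exact (T' y).2
  m

lemma inclRestrict_comp_liftRestrict (I : ClosedIdeal (UnitizL1 A))
    (T : I.toBMod.X →L[ℂ] I.toBMod.X) (hT : ∀ y, idealFst I (T y) = 0) :
    (inclRestrict I).comp (liftRestrict I T hT) = T := by
  refine ContinuousLinearMap.ext fun y : I.car => Subtype.ext (ext' ?_ rfl)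
  exact (hT y).symm

/-- Some element of a subspace of the unitization spans a complement of the augmentation
ideal in it. -/
lemma exists_mem_fst_mul_eq (V : Submodule ℂ (UnitizL1 A)) :
    ∃ e : V, ∀ y : V, fstCLM A y * fstCLM A e = fstCLM A y := by
  by_cases h : ∃ y : V, fstCLM A y ≠ 0
  · obtain ⟨y, hy⟩ := h
    refine ⟨(fstCLM A y)⁻¹ • y, fun z => ?_⟩
    rw [Submodule.coe_smul, map_smul, smul_eq_mul, inv_mul_cancel₀ hy, mul_one]
  · push Not at h
    exact ⟨0, fun y => by simp [h y]⟩

lemma act_one (I : ClosedIdeal (UnitizL1 A)) (n : ℕ) (F : (I.toBMod.iter n).X) :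
    (I.toBMod.iter n).act.l 1 F = F ∧ (I.toBMod.iter n).act.r 1 F = F := by
  have hl : I.toBMod.act.l 1 = .id ℂ _ :=
    ContinuousLinearMap.ext fun y : I.car => Subtype.ext (one_mul (y : UnitizL1 A))
  have hr : I.toBMod.act.r 1 = .id ℂ _ :=
    ContinuousLinearMap.ext fun y : I.car => Subtype.ext (mul_one (y : UnitizL1 A))
  have h := iterPair_act I.toBMod 1 n
  rw [hl, hr, iterPair_id] at h
  exact ⟨(congrArg (fun p => p.1 F) h).symm, (congrArg (fun p => p.2 F) h).symm⟩

end UnitizL1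

/-- The whole algebra as a closed ideal. -/
def ClosedIdeal.top (A : Type u) [NonUnitalNormedRing A] [NormedSpace ℂ A]
    [SMulCommClass ℂ A A] [IsScalarTower ℂ A A] : ClosedIdeal A where
  car := ⊤
  isClosed := isClosed_univ
  mul_mem_left _ _ _ := trivial
  mul_mem_right _ _ _ := trivial

namespace UnitizL1

variable {A : Type u} [NonUnitalNormedRing A] [NormedSpace ℂ A]
  [SMulCommClass ℂ A A] [IsScalarTower ℂ A A]

section Derivation

variable {I : ClosedIdeal (UnitizL1 A)} {n : ℕ} {D : A →L[ℂ] (I.toBMod.iter n).X}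

/-- A derivation into `I⁽ⁿ⁾` takes values in the annihilator of `A`. -/
lemma act_derivation_eq_zero (hcomm : ∀ a b : A, a * b = b * a)
    (h : NIdeallyAmenable A n)
    (hD : ∀ a b, D (a * b) = (I.toBMod.iter n).act.l (inrCLM A a) (D b) +
      (I.toBMod.iter n).act.l (inrCLM A b) (D a)) (x a : A) :
    (I.toBMod.iter n).act.l (inrCLM A x) (D a) = 0 := by
  have hcomm' := mul_comm_of_comm hcomm
  have hx (y : I.car) : idealFst I (I.toBMod.act.l (inrCLM A x) y) = 0 := by
    change fstCLM A (inrCLM A x * y) = 0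
    rw [fstCLM_mul, fstCLM_inrCLM, zero_mul]
  have hι := inclRestrict_comp_liftRestrict I (I.toBMod.act.l (inrCLM A x)) hx
  set m := liftRestrict I (I.toBMod.act.l (inrCLM A x)) hx
  have hint (b : A) := iterPair_intertwine (M := I.toBMod) (N := (restrictIdeal I).toBMod)
    (ClosedIdeal.act_l_eq_act_r hcomm' I (inrCLM A b)) (ClosedIdeal.act_l_eq_act_r hcomm (restrictIdeal I) b)
    (f := m) (g := inclRestrict I)
    (ContinuousLinearMap.ext fun y : I.car => Subtype.ext <| by
      change b * sndCLM A (inrCLM A x * y) = sndCLM A (inrCLM A x * (inrCLM A b * y))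
      rw [← mul_assoc, hcomm' (inrCLM A x) (inrCLM A b), mul_assoc, sndCLM_mul (inrCLM A b),
        fstCLM_mul]
      simp)
    (ContinuousLinearMap.ext fun y : (restrictIdeal I).car => Subtype.ext (inrCLM_mul b y)) n
  have hz := eq_zero_of_H1Zero_of_comm hcomm (restrictIdeal I) (h _)
    ((iterPair I.toBMod (restrictIdeal I).toBMod m (inclRestrict I) n).1.comp D)
    (fun a b => by
      simp only [ContinuousLinearMap.comp_apply]
      rw [hint, hint, hD, map_add]) a
  rw [iter_act_l_eq (ClosedIdeal.act_l_eq_act_r hcomm' I _)]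
  rw [← hι]
  have hc := iterPair_comp_apply I.toBMod (restrictIdeal I).toBMod I.toBMod
    m (inclRestrict I) (inclRestrict I) m n (D a)
  rw [ContinuousLinearMap.comp_apply] at hz
  rw [hz, map_zero] at hc
  exact hc.symm

/-- The rank one operator `y ↦ φ(y) e` on an ideal, for `φ` the augmentation character. -/
def rankOne (I : ClosedIdeal (UnitizL1 A)) (e : I.car) : I.toBMod.X →L[ℂ] I.toBMod.X :=
  (idealFst I).smulRight (show I.toBMod.X from e)

lemma iterPair_rankOne_eq_zero (hcomm : ∀ a b : A, a * b = b * a)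
    (h : NIdeallyAmenable A n)
    (hact : ∀ x a, (I.toBMod.iter n).act.l (inrCLM A x) (D a) = 0)
    (hmul : ∀ a b, D (a * b) = 0) (e : I.car) (a : A) :
    (iterPair I.toBMod I.toBMod (rankOne I e) (rankOne I e) n).1 (D a) = 0 := by
  have hcomm' := mul_comm_of_comm hcomm
  refine SeparatingDual.eq_zero_of_forall_dual_eq_zero (R := ℂ) fun ψ => ?_
  set T := rankOne I e
  let lam : A →L[ℂ] ℂ := ψ.comp ((iterPair I.toBMod I.toBMod T T n).1.comp D)
  have hlam (x y : A) : lam (x * y) = 0 := by simp [lam, hmul]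
  change lam a = 0
  have hleft : lam a • (iterPair I.toBMod I.toBMod T 0 n).1 (D a) = 0 := by
    let L' : I.car →L[ℂ] I.car := (lam.comp ((sndCLM A).comp I.car.subtypeL)).smulRight e
    let L : I.toBMod.X →L[ℂ] I.toBMod.X := L'
    have hL : L.comp (I.toBMod.act.l (inrCLM A a)) = lam a • T :=
      ContinuousLinearMap.ext fun y : I.car => by
        change lam (sndCLM A (inrCLM A a * y)) • e = lam a • fstCLM A (y : UnitizL1 A) • e
        rw [sndCLM_mul, map_add, map_add, sndCLM_inrCLM, hlam, fstCLM_inrCLM, zero_smul, map_zero,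
          zero_add, add_zero, map_smul, smul_smul, smul_eq_mul, mul_comm]
    have hc := iterPair_comp_apply I.toBMod I.toBMod I.toBMod
      (I.toBMod.act.l (inrCLM A a)) (I.toBMod.act.l (inrCLM A a)) L 0 n (D a)
    have ha := hact a a
    rw [iter_act_l_eq (ClosedIdeal.act_l_eq_act_r hcomm' I _)] at ha
    rw [ha, map_zero] at hc
    have hs := iterPair_smul I.toBMod I.toBMod (lam a) T 0 n
    rw [← hL, smul_zero] at hs
    rw [ContinuousLinearMap.comp_zero] at hc
    exact (hc.trans (congrArg (fun p => p.1 (D a)) hs)).symm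
  have hright : lam a • (iterPair I.toBMod I.toBMod 0 T n).1 (D a) = 0 := by
    let P := ClosedIdeal.top A
    let q' : P.car →L[ℂ] I.car := (lam.comp P.car.subtypeL).smulRight e
    let q : P.toBMod.X →L[ℂ] I.toBMod.X := q'
    let r' : I.car →L[ℂ] P.car :=
      ((fstCLM A).comp I.car.subtypeL).smulRight (⟨a, trivial⟩ : P.car)
    let r : I.toBMod.X →L[ℂ] P.toBMod.X := r'
    have hqr : q.comp r = lam a • T := ContinuousLinearMap.ext fun y : I.car => by
      change lam (fstCLM A y • a) • e = lam a • fstCLM A y • e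
      rw [map_smul, smul_smul, smul_eq_mul, mul_comm]
    have hq (b : A) : q.comp (P.toBMod.act.l b) = 0 := ContinuousLinearMap.ext fun y : P.car => by
      change lam (b * y) • e = 0
      rw [hlam, zero_smul]
    have hann (b a : A) :
        (P.toBMod.iter n).act.l b ((iterPair I.toBMod P.toBMod 0 q n).1 (D a)) = 0 := by
      rw [iter_act_l_eq (ClosedIdeal.act_l_eq_act_r hcomm P _), iterPair_comp_apply,
        ContinuousLinearMap.comp_zero]
      rw [hq]
      exact congrArg (fun p => p.1 (D a)) (iterPair_zero I.toBMod P.toBMod n)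
    have hz := eq_zero_of_H1Zero_of_comm hcomm P (h _)
      ((iterPair I.toBMod P.toBMod 0 q n).1.comp D)
      (fun a b => by simp only [ContinuousLinearMap.comp_apply, hann, hmul, map_zero, add_zero]) a
    rw [ContinuousLinearMap.comp_apply] at hz
    have hc := iterPair_comp_apply I.toBMod P.toBMod I.toBMod 0 q 0 r n (D a)
    rw [hz, map_zero, ContinuousLinearMap.comp_zero] at hc
    have hs := iterPair_smul I.toBMod I.toBMod (lam a) 0 T n
    rw [← hqr, smul_zero] at hs
    exact (hc.trans (congrArg (fun p => p.1 (D a)) hs)).symm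
  have hsum := iterPair_add I.toBMod I.toBMod T 0 0 T n
  rw [add_zero, zero_add] at hsum
  have hval : (iterPair I.toBMod I.toBMod T T n).1 (D a) =
      (iterPair I.toBMod I.toBMod T 0 n).1 (D a) + (iterPair I.toBMod I.toBMod 0 T n).1 (D a) :=
    congrArg (fun p => p.1 (D a)) hsum
  have hsq : lam a • (iterPair I.toBMod I.toBMod T T n).1 (D a) = 0 := by
    rw [hval, smul_add, hleft, hright, add_zero]
  have hsq' : lam a * lam a = 0 := by
    have := congrArg ψ hsq
    rwa [map_smul, map_zero] at this
  exact mul_self_eq_zero.mp hsq'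

lemma derivation_eq_zero (hcomm : ∀ a b : A, a * b = b * a)
    (h : NIdeallyAmenable A n)
    (hD : ∀ a b, D (a * b) = (I.toBMod.iter n).act.l (inrCLM A a) (D b) +
      (I.toBMod.iter n).act.l (inrCLM A b) (D a)) (a : A) : D a = 0 := by
  have hcomm' := mul_comm_of_comm hcomm
  have hact := act_derivation_eq_zero hcomm h hD
  have hmul (a b : A) : D (a * b) = 0 := by rw [hD, hact, hact, add_zero]
  obtain ⟨e, he⟩ := exists_mem_fst_mul_eq I.car
  have hT := iterPair_rankOne_eq_zero hcomm h hact hmul e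
  let c : I.toBMod.X →L[ℂ] I.toBMod.X := ContinuousLinearMap.id ℂ I.toBMod.X - rankOne I e
  have hp : ∀ y, idealFst I (c y) = 0 := fun y : I.car => by
    change fstCLM A ((y : UnitizL1 A) - fstCLM A y • (e : UnitizL1 A)) = 0
    rw [map_sub, map_smul, smul_eq_mul, he, sub_self]
  have hιp := inclRestrict_comp_liftRestrict I c hp
  set p := liftRestrict I c hp
  have hann (x a : A) : ((restrictIdeal I).toBMod.iter n).act.l x
      ((iterPair I.toBMod (restrictIdeal I).toBMod p (inclRestrict I) n).1 (D a)) = 0 := by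
    have hxe (y : I.car) : idealFst I (rankOne I (I.lAct (inrCLM A x) e) y) = 0 := by
      change fstCLM A (fstCLM A y • (inrCLM A x * (e : UnitizL1 A))) = 0
      rw [map_smul, fstCLM_mul, fstCLM_inrCLM, zero_mul, smul_zero]
    let N := liftRestrict I (rankOne I (I.lAct (inrCLM A x) e)) hxe
    have hNT : N.comp (rankOne I e) = N := ContinuousLinearMap.ext fun y : I.car =>
      Subtype.ext <| by
        change sndCLM A (fstCLM A (fstCLM A y • (e : UnitizL1 A)) • (inrCLM A x * e)) =
          sndCLM A (fstCLM A y • (inrCLM A x * (e : UnitizL1 A)))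
        rw [map_smul (fstCLM A), smul_eq_mul, he]
    have hpN : p.comp (I.toBMod.act.l (inrCLM A x)) = ((restrictIdeal I).toBMod.act.l x).comp p + N :=
      ContinuousLinearMap.ext fun y : I.car => Subtype.ext <| by
        change sndCLM A (inrCLM A x * y - fstCLM A (inrCLM A x * y) • (e : UnitizL1 A)) =
          x * sndCLM A (y - fstCLM A y • (e : UnitizL1 A)) +
            sndCLM A (fstCLM A y • (inrCLM A x * (e : UnitizL1 A)))
        have hy := he y
        simp only [map_sub, map_smul, sndCLM_mul, fstCLM_mul, fstCLM_inrCLM, sndCLM_inrCLM,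
          zero_mul, zero_smul, zero_add, sub_zero, mul_sub, smul_add, smul_smul, mul_smul_comm, hy]
        abel
    have hι : (I.toBMod.act.l (inrCLM A x)).comp (inclRestrict I) =
        (inclRestrict I).comp ((restrictIdeal I).toBMod.act.l x) + 0 := by
      rw [add_zero]
      exact ContinuousLinearMap.ext fun y : (restrictIdeal I).car =>
        Subtype.ext (inrCLM_mul x y).symm
    have hadd := iterPair_add I.toBMod (restrictIdeal I).toBMod
      (((restrictIdeal I).toBMod.act.l x).comp p) N ((inclRestrict I).comp ((restrictIdeal I).toBMod.act.l x)) 0 n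
    rw [← hpN, ← hι] at hadd
    have hN := iterPair_comp_apply I.toBMod I.toBMod (restrictIdeal I).toBMod
      (rankOne I e) (rankOne I e) N 0 n (D a)
    rw [hT, map_zero, hNT, ContinuousLinearMap.comp_zero] at hN
    have hx := hact x a
    rw [iter_act_l_eq (ClosedIdeal.act_l_eq_act_r hcomm' I _)] at hx
    have hpx := iterPair_comp_apply I.toBMod I.toBMod (restrictIdeal I).toBMod
      (I.toBMod.act.l (inrCLM A x)) (I.toBMod.act.l (inrCLM A x)) p (inclRestrict I) n (D a)
    rw [hx, map_zero] at hpx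
    have hval := hpx.trans (congrArg (fun p => p.1 (D a)) hadd)
    rw [Prod.fst_add, add_apply, ← hN, add_zero] at hval
    rw [iter_act_l_eq (ClosedIdeal.act_l_eq_act_r hcomm (restrictIdeal I) _), iterPair_comp_apply]
    exact hval.symm
  have hz := eq_zero_of_H1Zero_of_comm hcomm (restrictIdeal I) (h _)
    ((iterPair I.toBMod (restrictIdeal I).toBMod p (inclRestrict I) n).1.comp D)
    (fun a b => by simp only [ContinuousLinearMap.comp_apply, hann, hmul, map_zero, add_zero]) a
  rw [ContinuousLinearMap.comp_apply] at hz
  have hc := iterPair_comp_apply I.toBMod (restrictIdeal I).toBMod I.toBMod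
    p (inclRestrict I) (inclRestrict I) p n (D a)
  rw [hz, map_zero, hιp] at hc
  have hadd := iterPair_add I.toBMod I.toBMod c (rankOne I e) c (rankOne I e) n
  rw [show c + rankOne I e = ContinuousLinearMap.id ℂ I.toBMod.X from sub_add_cancel _ _] at hadd
  have hid := (iterPair_id I.toBMod n).symm.trans hadd
  have hval : D a = (iterPair I.toBMod I.toBMod c c n).1 (D a) +
      (iterPair I.toBMod I.toBMod (rankOne I e) (rankOne I e) n).1 (D a) :=
    congrArg (fun p => p.1 (D a)) hid
  rw [hval, hT, add_zero]
  exact hc.symm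

end Derivation

end UnitizL1

/-- **Proposition 2.1(iii).** If `A` is commutative and `n`-ideally amenable, then
the unitization `A# = A ⊕ ℂ` is `n`-ideally amenable. -/
theorem unitization_ideally_amenable_of_comm
    {A : Type u} [NonUnitalNormedRing A] [NormedSpace ℂ A]
    [SMulCommClass ℂ A A] [IsScalarTower ℂ A A] [CompleteSpace A]
    (hcomm : ∀ a b : A, a * b = b * a)
    (n : ℕ) (hn : 1 ≤ n)
    (h : NIdeallyAmenable A n) :
    NIdeallyAmenable (UnitizL1 A) n := by
  intro I D hD
  have hsymm (x : UnitizL1 A) : (I.toBMod.iter n).act.l x = (I.toBMod.iter n).act.r x :=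
    iter_act_l_eq_r (ClosedIdeal.act_l_eq_act_r (UnitizL1.mul_comm_of_comm hcomm) I x) n
  have hA (a : A) : D (UnitizL1.inrCLM A a) = 0 :=
    UnitizL1.derivation_eq_zero (D := D.comp (UnitizL1.inrCLM A)) hcomm h
      (fun a b => by
        simp only [ContinuousLinearMap.comp_apply]
        rw [UnitizL1.inrCLM_mul, hD, hsymm (UnitizL1.inrCLM A b)]) a
  have hone : D 1 = 0 := by
    have h1 := hD 1 1
    rwa [mul_one, (UnitizL1.act_one I n _).1, (UnitizL1.act_one I n _).2, left_eq_add] at h1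
  refine ⟨0, fun x => ?_⟩
  rw [UnitizL1.eq_add_smul_one x, map_add, map_smul, hA, hone]
  simp
end
end
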